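/- Let D ⊆ ℝⁿ be open, let H : D × ℝⁿ → ℝ be continuous and satisfy (H1)–(H3), and let ℓ(x,y) := sup{⟨y,θ⟩ : θ ∈ ℝⁿ, H(x,θ) ≤ 0} be the induced local action. Then for every x ∈ D: H(x,0) = 0 if and only if there exists y ∈ ℝⁿ with y ≠ 0 and ℓ(x,y) = 0. -/

import Mathlib

open MeasureTheory Set Filter
open scoped RealInnerProductSpace

abbrev Euc (n : ℕ) := EuclideanSpace ℝ (Fin n)

/-- Second-order Taylor lower bound on `[0, 1]` for a function with `c ≤ f''`. -/
theorem add_deriv_add_half_le_of_le_second_deriv {f f' f'' : ℝ → ℝ} {c : ℝ}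
    (hf : ∀ t, HasDerivAt f (f' t) t) (hf' : ∀ t, HasDerivAt f' (f'' t) t)
    (hc : ∀ t, c ≤ f'' t) : f 0 + f' 0 + c / 2 ≤ f 1 := by
  have hslope : Monotone fun t => f' t - c * t :=
    monotone_of_hasDerivAt_nonneg
      (fun t => (hf' t).sub ((hasDerivAt_id t).const_mul c))
      (fun t => by simpa using hc t)
  have hd : ∀ t, HasDerivAt (fun t => f t - f' 0 * t - c / 2 * t ^ 2)
      (f' t - f' 0 - c * t) t := fun t => by
    refine (((hf t).sub ((hasDerivAt_id t).const_mul (f' 0))).sub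
      (((hasDerivAt_id t).pow 2).const_mul (c / 2))).congr_deriv ?_
    simp
    ring
  have hmono : MonotoneOn (fun t => f t - f' 0 * t - c / 2 * t ^ 2) (Set.Ici 0) := by
    refine monotoneOn_of_deriv_nonneg (convex_Ici 0)
      (fun t _ => (hd t).continuousAt.continuousWithinAt)
      (fun t _ => (hd t).differentiableAt.differentiableWithinAt) fun t ht => ?_
    rw [interior_Ici] at ht
    have h := hslope (le_of_lt ht)
    simp only [mul_zero, sub_zero] at h
    rw [(hd t).deriv]
    linarith
  have h := hmono Set.self_mem_Ici (Set.mem_Ici.2 zero_le_one) zero_le_one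
  norm_num at h
  linarith

section StrongConvexity

variable {E : Type*} [NormedAddCommGroup E] [InnerProductSpace ℝ E]

/-- A function whose Hessian is bounded below by `m` lies above the corresponding paraboloid
tangent at the origin. -/
theorem paraboloid_le_of_hessian_lower_bound [CompleteSpace E]
    {f : E → ℝ} {g : E → E} {A : E → E →L[ℝ] E} {m : ℝ}
    (hf : ∀ θ, HasGradientAt f (g θ) θ) (hg : ∀ θ, HasFDerivAt g (A θ) θ)
    (hA : ∀ θ ξ, m * ‖ξ‖ ^ 2 ≤ ⟪ξ, A θ ξ⟫) (θ : E) :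
    f 0 + ⟪g 0, θ⟫ + m / 2 * ‖θ‖ ^ 2 ≤ f θ := by
  have hline : ∀ t : ℝ, HasDerivAt (fun t : ℝ => t • θ) θ t := fun t => by
    simpa using (hasDerivAt_id t).smul_const θ
  have h1 : ∀ t : ℝ, HasDerivAt (fun t : ℝ => f (t • θ)) ⟪g (t • θ), θ⟫ t := fun t => by
    simpa [Function.comp_def] using (hf (t • θ)).hasFDerivAt.comp_hasDerivAt t (hline t)
  have h2 : ∀ t : ℝ, HasDerivAt (fun t : ℝ => ⟪g (t • θ), θ⟫) ⟪θ, A (t • θ) θ⟫ t := fun t => by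
    have h := ((hg (t • θ)).comp_hasDerivAt t (hline t)).inner ℝ (hasDerivAt_const t θ)
    simpa [real_inner_comm] using h
  have h := add_deriv_add_half_le_of_le_second_deriv h1 h2 fun t => hA (t • θ) θ
  simp only [zero_smul, one_smul] at h
  linarith

/-- Linear functionals are bounded above on sublevel sets of a function lying above a
paraboloid. -/
theorem bddAbove_inner_image_sublevel {f : E → ℝ} {v : E} {m : ℝ} (hm : 0 < m)
    (hf : ∀ θ, f 0 + ⟪v, θ⟫ + m / 2 * ‖θ‖ ^ 2 ≤ f θ) (y : E) :
    BddAbove ((fun θ => ⟪y, θ⟫) '' {θ | f θ ≤ 0}) := by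
  refine ⟨‖y - v‖ ^ 2 / (2 * m) - f 0, ?_⟩
  rintro _ ⟨θ, hθ, rfl⟩
  have hθ' : f θ ≤ 0 := hθ
  have hcs := real_inner_le_norm (y - v) θ
  rw [inner_sub_left] at hcs
  have hyoung : ‖y - v‖ * ‖θ‖ ≤ ‖y - v‖ ^ 2 / (2 * m) + m / 2 * ‖θ‖ ^ 2 := by
    have hsq : ‖y - v‖ ^ 2 / (2 * m) + m / 2 * ‖θ‖ ^ 2 - ‖y - v‖ * ‖θ‖ =
        (‖y - v‖ - m * ‖θ‖) ^ 2 / (2 * m) := by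
      field_simp
      ring
    have hnonneg : 0 ≤ (‖y - v‖ - m * ‖θ‖) ^ 2 / (2 * m) := by positivity
    linarith
  have h := hf θ
  change ⟪y, θ⟫ ≤ _
  linarith

/-- If `f 0 < 0`, then the support function of `{f ≤ 0}` is positive in every direction. -/
theorem sSup_inner_image_sublevel_pos {f : E → ℝ} (hf : ContinuousAt f 0) (h0 : f 0 < 0)
    {y : E} (hy : y ≠ 0) (hbdd : BddAbove ((fun θ => ⟪y, θ⟫) '' {θ | f θ ≤ 0})) :
    0 < sSup ((fun θ => ⟪y, θ⟫) '' {θ | f θ ≤ 0}) := by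
  have hline : Filter.Tendsto (fun t : ℝ => t • y) (nhdsWithin 0 (Set.Ioi 0)) (nhds 0) := by
    have h : Continuous fun t : ℝ => t • y := by fun_prop
    simpa using (h.tendsto 0).mono_left nhdsWithin_le_nhds
  obtain ⟨t, hneg, ht⟩ := ((hline.eventually (hf.eventually_lt_const h0)).and
    self_mem_nhdsWithin).exists
  have hpos : 0 < ⟪y, t • y⟫ := by
    rw [real_inner_smul_right]
    exact mul_pos ht (real_inner_self_pos.2 hy)
  exact hpos.trans_le (le_csSup hbdd ⟨t • y, le_of_lt hneg, rfl⟩)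

/-- If `f 0 = 0` and `f` lies above a paraboloid, then the support function of `{f ≤ 0}`
vanishes in some nonzero direction. -/
theorem exists_sSup_inner_image_sublevel_eq_zero [Nontrivial E] {f : E → ℝ} {v : E} {m : ℝ}
    (hm : 0 < m) (hf : ∀ θ, f 0 + ⟪v, θ⟫ + m / 2 * ‖θ‖ ^ 2 ≤ f θ) (h0 : f 0 = 0) :
    ∃ y : E, y ≠ 0 ∧ sSup ((fun θ => ⟪y, θ⟫) '' {θ | f θ ≤ 0}) = 0 := by
  suffices h : ∃ y : E, y ≠ 0 ∧ ∀ θ, f θ ≤ 0 → ⟪y, θ⟫ ≤ 0 by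
    obtain ⟨y, hy, hle⟩ := h
    refine ⟨y, hy, IsGreatest.csSup_eq ⟨⟨0, h0.le, inner_zero_right y⟩, ?_⟩⟩
    rintro _ ⟨θ, hθ, rfl⟩
    exact hle θ hθ
  by_cases hv : v = 0
  · obtain ⟨y, hy⟩ := exists_ne (0 : E)
    refine ⟨y, hy, fun θ hθ => ?_⟩
    have h := hf θ
    rw [hv, inner_zero_left, h0] at h
    have hsq : ‖θ‖ ^ 2 ≤ 0 := by
      by_contra! hpos
      have := mul_pos (half_pos hm) hpos
      linarith
    have hθ0 : θ = 0 := by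
      simpa using le_antisymm hsq (sq_nonneg ‖θ‖)
    simp [hθ0]
  · refine ⟨v, hv, fun θ hθ => ?_⟩
    have h := hf θ
    have hnonneg : 0 ≤ m / 2 * ‖θ‖ ^ 2 := by positivity
    linarith

end StrongConvexity

/-- for a Hamiltonian geometric action, `H(x,0) = 0` if and only
if `ℓ(x,y) = 0` for some `y ≠ 0`. -/
theorem statement3 {n : ℕ} (hn : 0 < n)
    (D : Set (Euc n)) (hD : IsOpen D) (hDne : D.Nonempty)
    (H : Euc n → Euc n → ℝ)
    (Hθ : Euc n → Euc n → Euc n)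
    (Hθθ : Euc n → Euc n → (Euc n →L[ℝ] Euc n))
    (hHcont : ContinuousOn (fun p : Euc n × Euc n => H p.1 p.2) (D ×ˢ Set.univ))
    (hH1 : ∀ x ∈ D, H x 0 ≤ 0)
    (hHθ : ∀ x ∈ D, ∀ θ : Euc n, HasGradientAt (H x) (Hθ x θ) θ)
    (hHθθ : ∀ x ∈ D, ∀ θ : Euc n, HasFDerivAt (Hθ x) (Hθθ x θ) θ)
    (hHθcont : ContinuousOn (fun p : Euc n × Euc n => Hθ p.1 p.2) (D ×ˢ Set.univ))
    (hHθθcont : ContinuousOn (fun p : Euc n × Euc n => Hθθ p.1 p.2) (D ×ˢ Set.univ))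
    (hH3 : ∀ K ⊆ D, IsCompact K → ∃ m > (0:ℝ), ∀ x ∈ K, ∀ θ ξ : Euc n,
      m * ‖ξ‖ ^ 2 ≤ ⟪ξ, Hθθ x θ ξ⟫)
    (ℓ : Euc n → Euc n → ℝ)
    (hℓdef : ∀ x y : Euc n, ℓ x y = sSup ((fun θ => ⟪y, θ⟫) '' {θ | H x θ ≤ 0})) :
    ∀ x ∈ D, (H x 0 = 0 ↔ ∃ y : Euc n, y ≠ 0 ∧ ℓ x y = 0) := by
  intro x hx
  obtain ⟨m, hm, hess⟩ := hH3 {x} (Set.singleton_subset_iff.2 hx) isCompact_singleton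
  have hpar := paraboloid_le_of_hessian_lower_bound (hHθ x hx) (hHθθ x hx)
    (hess x (Set.mem_singleton x))
  simp only [hℓdef]
  constructor
  · intro h0
    have : Nonempty (Fin n) := ⟨⟨0, hn⟩⟩
    exact exists_sSup_inner_image_sublevel_eq_zero hm hpar h0
  · rintro ⟨y, hy, hsup⟩
    by_contra hne
    exact (sSup_inner_image_sublevel_pos (hHθ x hx 0).hasFDerivAt.continuousAt
      (lt_of_le_of_ne (hH1 x hx) hne) hy (bddAbove_inner_image_sublevel hm hpar y)).ne' hsup
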